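/- Let α, β ∈ ℂ with α − β + 1 not a nonpositive integer. Then the series Σ_{k=0}^∞ 1/( k! · (α−β+1)_k · (β+1)_{−k} · (−α+1)_{−k} ) converges absolutely and equals Γ(α−β+1) · (1/Γ(α+1)) · (1/Γ(1−β)), where 1/Γ denotes the (entire) reciprocal Gamma function. -/

import Mathlib

noncomputable section

open Filter Topology Asymptotics

def Pq (s : ℂ) (n : ℕ) : ℂ := (ascPochhammer ℂ n).eval s

lemma Pq_succ (s : ℂ) (n : ℕ) : Pq s (n+1) = Pq s n * (s + n) := ascPochhammer_succ_eval n s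

lemma Pq_zero (s : ℂ) : Pq s 0 = 1 := by simp [Pq]

lemma Pq_left (s : ℂ) (n : ℕ) : Pq s (n+1) = s * Pq (s+1) n := by
  induction n with
  | zero => simp [Pq_succ, Pq_zero]
  | succ n ih => rw [Pq_succ, ih, Pq_succ]; push_cast; ring

lemma Pq_prod (s : ℂ) (n : ℕ) : Pq s n = ∏ j ∈ Finset.range n, (s + j) := by
  induction n with
  | zero => simp [Pq_zero]
  | succ n ih => rw [Pq_succ, ih, Finset.prod_range_succ]

lemma Pq_ne_zero {s : ℂ} (h : ∀ j : ℕ, s ≠ -(j : ℂ)) (n : ℕ) : Pq s n ≠ 0 := by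
  rw [Pq_prod, Finset.prod_ne_zero_iff]
  intro j _ h0
  exact h j (eq_neg_of_add_eq_zero_left h0)

lemma Pq_gamma (s : ℂ) {n : ℕ} (hn : n ≠ 0) :
    Pq s (n+1) = (n : ℂ) ^ s * (n.factorial : ℂ) * (Complex.GammaSeq s n)⁻¹ := by
  have h1 : (n : ℂ) ≠ 0 := Nat.cast_ne_zero.mpr hn
  have h2 : (n : ℂ) ^ s ≠ 0 := by simp [Complex.cpow_eq_zero_iff, h1]
  have h3 : (n.factorial : ℂ) ≠ 0 := Nat.cast_ne_zero.mpr n.factorial_ne_zero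
  rw [Complex.GammaSeq, ← Pq_prod, inv_div]
  field_simp

lemma gammaSeq_inv_tendsto (s : ℂ) :
    Tendsto (fun n => (Complex.GammaSeq s n)⁻¹) atTop (𝓝 (Complex.Gamma s)⁻¹) := by
  by_cases h : Complex.Gamma s = 0
  · obtain ⟨m, rfl⟩ := (Complex.Gamma_eq_zero_iff s).1 h
    rw [h]
    refine (tendsto_congr' ?_).2 (tendsto_const_nhds (x := (0:ℂ)⁻¹))
    filter_upwards [eventually_ge_atTop m] with n hn
    have : ∏ j ∈ Finset.range (n + 1), (-(m : ℂ) + j) = 0 :=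
      Finset.prod_eq_zero (i := m) (by simp; omega) (by simp)
    rw [Complex.GammaSeq, this, div_zero]
  · exact (Complex.GammaSeq_tendsto_Gamma s).inv₀ h

def Tq (a b : ℂ) (k : ℕ) : ℂ := Pq a k * Pq b k / ((k.factorial : ℂ) * Pq (a + b + 1) k)

lemma Tq_sum (a b : ℂ) (h : ∀ j : ℕ, a + b + 1 ≠ -(j : ℂ)) (n : ℕ) :
    ∑ k ∈ Finset.range (n+1), Tq a b k =
      Pq (a+1) n * Pq (b+1) n / ((n.factorial : ℂ) * Pq (a+b+1) n) := by
  induction n with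
  | zero => simp [Tq, Pq_zero]
  | succ n ih =>
    have h1 := Pq_ne_zero h n
    have h2 : a + b + 1 + n ≠ 0 := fun h0 => h n (eq_neg_of_add_eq_zero_left h0)
    have h3 : (n.factorial : ℂ) ≠ 0 := Nat.cast_ne_zero.mpr n.factorial_ne_zero
    have h4 : (n : ℂ) + 1 ≠ 0 := Nat.cast_add_one_ne_zero n
    rw [Finset.sum_range_succ, ih, Tq, Pq_left a, Pq_left b, Pq_succ (a+b+1), Pq_succ (a+1),
      Pq_succ (b+1), Nat.factorial_succ]
    push_cast
    field_simp
    ring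

lemma Pq_ratio (a b c e : ℂ) (he : a + b = c + e) {n : ℕ} (hn : n ≠ 0) :
    Pq a (n+1) * Pq b (n+1) / (((n+1).factorial : ℂ) * Pq c (n+1)) =
      (n : ℂ) ^ e / (n + 1) * (Complex.GammaSeq c n * (Complex.GammaSeq a n)⁻¹ *
        (Complex.GammaSeq b n)⁻¹) := by
  have h1 : (n : ℂ) ≠ 0 := Nat.cast_ne_zero.mpr hn
  have h2 : (n : ℂ) ^ c ≠ 0 := by simp [Complex.cpow_eq_zero_iff, h1]
  have h3 : (n.factorial : ℂ) ≠ 0 := Nat.cast_ne_zero.mpr n.factorial_ne_zero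
  have h4 : (n : ℂ) + 1 ≠ 0 := Nat.cast_add_one_ne_zero n
  have h5 : (n : ℂ) ^ a * (n : ℂ) ^ b = (n : ℂ) ^ c * (n : ℂ) ^ e := by
    rw [← Complex.cpow_add _ _ h1, ← Complex.cpow_add _ _ h1, he]
  rw [Pq_gamma a hn, Pq_gamma b hn, Pq_gamma c hn, Nat.factorial_succ]
  push_cast
  generalize (Complex.GammaSeq a n)⁻¹ = A
  generalize (Complex.GammaSeq b n)⁻¹ = B
  have : (n : ℂ) ^ a * (n.factorial : ℂ) * A * ((n : ℂ) ^ b * (n.factorial : ℂ) * B) =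
    (n : ℂ) ^ c * (n : ℂ) ^ e * (n.factorial : ℂ) ^ 2 * A * B := by rw [← h5]; ring
  rw [this]
  generalize Complex.GammaSeq c n = C
  rw [div_eq_mul_inv, mul_inv, mul_inv, mul_inv, mul_inv, inv_inv]
  field_simp

lemma Tq_summable (a b : ℂ) : Summable (fun k => ‖Tq a b k‖) := by
  rw [← summable_nat_add_iff 1]
  have hW : Tendsto (fun n => Complex.GammaSeq (a+b+1) n * (Complex.GammaSeq a n)⁻¹ *
        (Complex.GammaSeq b n)⁻¹) atTop (𝓝 _) :=
    ((Complex.GammaSeq_tendsto_Gamma (a+b+1)).mul (gammaSeq_inv_tendsto a)).mul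
      (gammaSeq_inv_tendsto b)
  have hs : Summable (fun n : ℕ => ((n : ℝ) ^ 2)⁻¹) := by
    simpa using (Real.summable_nat_pow_inv (p := 2)).2 (by norm_num)
  refine summable_of_isBigO_nat hs ?_
  have h1 : (fun n : ℕ => (n : ℂ) ^ (-1 : ℂ) / (n + 1)) =O[atTop] (fun n : ℕ => ((n : ℝ) ^ 2)⁻¹) := by
    refine IsBigO.of_bound 1 ?_
    filter_upwards [eventually_ge_atTop 1] with n hn
    have hp : (0 : ℝ) < n := by exact_mod_cast hn
    have : ‖(n : ℂ) + 1‖ = (n : ℝ) + 1 := by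
      have := Complex.norm_natCast (n + 1)
      push_cast at this
      exact this
    rw [Complex.cpow_neg_one, norm_div, norm_inv, Complex.norm_natCast, this, one_mul, norm_inv,
      norm_pow, Real.norm_of_nonneg hp.le, pow_two, mul_inv, div_eq_mul_inv]
    gcongr
    linarith
  have h2 := (h1.mul (hW.isBigO_one ℝ)).norm_left
  simp only [mul_one] at h2
  refine h2.congr' ?_ EventuallyEq.rfl
  filter_upwards [eventually_ge_atTop 1] with n hn
  rw [Tq, Pq_ratio a b (a+b+1) (-1) (by ring) (by omega)]

lemma Tq_tsum (a b : ℂ) (h : ∀ j : ℕ, a + b + 1 ≠ -(j : ℂ)) :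
    ∑' k, Tq a b k = Complex.Gamma (a+b+1) * (Complex.Gamma (b+1))⁻¹ *
      (Complex.Gamma (a+1))⁻¹ := by
  have hs : Summable (Tq a b) := (Tq_summable a b).of_norm
  have h1 := (tendsto_add_atTop_iff_nat 2).2 hs.hasSum.tendsto_sum_nat
  refine tendsto_nhds_unique h1 ?_
  have hW := ((Complex.GammaSeq_tendsto_Gamma (a+b+1)).mul (gammaSeq_inv_tendsto (b+1))).mul
      (gammaSeq_inv_tendsto (a+1))
  have h2 := (tendsto_natCast_div_add_atTop (1 : ℂ)).mul hW
  rw [one_mul] at h2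
  refine h2.congr' ?_
  filter_upwards [eventually_ge_atTop 1] with n hn
  rw [Tq_sum a b h (n+1), Pq_ratio (a+1) (b+1) (a+b+1) 1 (by ring) (by omega), Complex.cpow_one]
  ring

/-- Gauss-type summation.  Here `(a)_k` (for `k ∈ ℕ`) is the ascending
Pochhammer symbol and the reciprocal of a Pochhammer symbol with negative index is
interpreted via `1/(a)_{-k} = (-1)^k (1-a)_k`, so that the `k`-th summand
`1/(k! (α-β+1)_k (β+1)_{-k} (-α+1)_{-k})` equals
`((-1)^k (-β)_k) ((-1)^k (α)_k) / (k! (α-β+1)_k)`. -/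
theorem stmt10 (α β : ℂ) (h : ∀ j : ℕ, α - β + 1 ≠ -(j : ℂ)) :
    Summable (fun k : ℕ =>
      ‖((-1 : ℂ) ^ k * (ascPochhammer ℂ k).eval (-β)) *
          ((-1 : ℂ) ^ k * (ascPochhammer ℂ k).eval α) /
          ((Nat.factorial k : ℂ) * (ascPochhammer ℂ k).eval (α - β + 1))‖) ∧
    ∑' k : ℕ,
        ((-1 : ℂ) ^ k * (ascPochhammer ℂ k).eval (-β)) *
          ((-1 : ℂ) ^ k * (ascPochhammer ℂ k).eval α) /
          ((Nat.factorial k : ℂ) * (ascPochhammer ℂ k).eval (α - β + 1)) =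
      Complex.Gamma (α - β + 1) * (Complex.Gamma (α + 1))⁻¹ *
        (Complex.Gamma (1 - β))⁻¹ := by
  have ht : (fun k : ℕ => ((-1 : ℂ) ^ k * (ascPochhammer ℂ k).eval (-β)) *
          ((-1 : ℂ) ^ k * (ascPochhammer ℂ k).eval α) /
          ((Nat.factorial k : ℂ) * (ascPochhammer ℂ k).eval (α - β + 1))) = Tq (-β) α := by
    funext k
    have hk : ((-1 : ℂ) ^ k) * (-1) ^ k = 1 := by rw [← mul_pow]; simp
    rw [Tq, Pq, Pq, Pq, show -β + α + 1 = α - β + 1 by ring, mul_mul_mul_comm, hk, one_mul]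
  have ht' := fun k => congrFun ht k
  simp only [ht']
  refine ⟨Tq_summable _ _, ?_⟩
  rw [Tq_tsum (-β) α (by
    intro j
    rw [show -β + α + 1 = α - β + 1 by ring]
    exact h j)]
  rw [show -β + α + 1 = α - β + 1 by ring, show -β + 1 = 1 - β by ring]
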